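/- The Krull dimension of R(A,𝔫,L) equals n − r + 1, and the grading group K = ℤ^n/(row span of P) has rank n − r; hence the K-grading of R(A,𝔫,L) is of complexity one, i.e., the rank of K equals dim R(A,𝔫,L) − 1. -/

import Mathlib

open MvPolynomial

section Setup

variable (𝕂 : Type) [Field 𝕂] [IsAlgClosed 𝕂] [CharZero 𝕂]
variable (r : ℕ) (a : Fin (r+1) → 𝕂 × 𝕂) (n : Fin (r+1) → ℕ)
variable (l : ∀ i : Fin (r+1), Fin (n i) → ℕ)

/-- The index set of the variables `T_{ij}`, `0 ≤ i ≤ r`, `1 ≤ j ≤ n_i`. -/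
abbrev Idx (r : ℕ) (n : Fin (r+1) → ℕ) := Σ i : Fin (r+1), Fin (n i)

/-- The monomial `T_i^{l_i} = T_{i1}^{l_{i1}} ⋯ T_{i n_i}^{l_{i n_i}}`. -/
noncomputable def mono (i : Fin (r+1)) : MvPolynomial (Idx r n) 𝕂 :=
  ∏ j : Fin (n i), (X ⟨i, j⟩ : MvPolynomial (Idx r n) 𝕂) ^ l i j

/-- `α_{ij} = det(a_i, a_j)`. -/
def alpha (i k : Fin (r+1)) : 𝕂 := (a i).1 * (a k).2 - (a k).1 * (a i).2

/-- The trinomial `g_{i,j,k} = α_{jk} T_i^{l_i} + α_{ki} T_j^{l_j} + α_{ij} T_k^{l_k}`. -/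
noncomputable def gPoly (i j k : Fin (r+1)) : MvPolynomial (Idx r n) 𝕂 :=
  C (alpha 𝕂 r a j k) * mono 𝕂 r n l i + C (alpha 𝕂 r a k i) * mono 𝕂 r n l j +
    C (alpha 𝕂 r a i j) * mono 𝕂 r n l k

/-- The ideal `⟨g_{i,i+1,i+2} ; 0 ≤ i ≤ r-2⟩`. -/
noncomputable def relIdeal : Ideal (MvPolynomial (Idx r n) 𝕂) :=
  Ideal.span { p | ∃ i j k : Fin (r+1), (j : ℕ) = (i : ℕ) + 1 ∧ (k : ℕ) = (i : ℕ) + 2 ∧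
    p = gPoly 𝕂 r a n l i j k }

/-- The ring `R(A, 𝔫, L)`. -/
abbrev RAnL := MvPolynomial (Idx r n) 𝕂 ⧸ relIdeal 𝕂 r a n l

/-- Row `i` (for `1 ≤ i ≤ r`) of the `r × n` matrix `P`. -/
def Prow (i : Fin r) : Idx r n → ℤ :=
  fun x => if x.1 = 0 then -(l x.1 x.2 : ℤ) else if x.1 = i.succ then (l x.1 x.2 : ℤ) else 0

/-- The subgroup of `ℤ^n` generated by the rows of `P`. -/
def rowSpan : AddSubgroup (Idx r n → ℤ) := AddSubgroup.closure (Set.range (Prow r n l))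

/-- The grading group `K = ℤ^n / P^*(M)`. -/
abbrev Kgrp := (Idx r n → ℤ) ⧸ rowSpan r n l

/-- The projection `Q : ℤ^n → K`. -/
noncomputable def Qmap : (Idx r n → ℤ) →+ Kgrp r n l := QuotientAddGroup.mk' (rowSpan r n l)

/-- The weight `deg T_{ij} := Q(e_{ij})` defining the `K`-grading of `S`. -/
noncomputable def wK : Idx r n → Kgrp r n l := fun x => Qmap r n l (Pi.single x (1 : ℤ))

/-- An element of `R(A,𝔫,L)` is homogeneous of degree `d` if it is the image of a
`K`-homogeneous polynomial of degree `d`. -/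
def IsHomog (d : Kgrp r n l) (y : RAnL 𝕂 r a n l) : Prop :=
  ∃ p : MvPolynomial (Idx r n) 𝕂, p.IsWeightedHomogeneous (wK r n l) d ∧
    Ideal.Quotient.mk (relIdeal 𝕂 r a n l) p = y

/-- `K`-prime elements of `R(A,𝔫,L)`. -/
def KPrime (f : RAnL 𝕂 r a n l) : Prop :=
  (∃ d, IsHomog 𝕂 r a n l d f) ∧ f ≠ 0 ∧ ¬ IsUnit f ∧
    ∀ x y : RAnL 𝕂 r a n l, (∃ d, IsHomog 𝕂 r a n l d x) → (∃ d, IsHomog 𝕂 r a n l d y) →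
      f ∣ x * y → f ∣ x ∨ f ∣ y

end Setup

section IntegralDimension

/-- An injective integral extension preserves the Krull dimension. -/
theorem ringKrullDim_eq_of_isIntegral_of_injective {R S : Type*} [CommRing R] [CommRing S]
    [Algebra R S] [Algebra.IsIntegral R S] (h : Function.Injective (algebraMap R S)) :
    ringKrullDim R = ringKrullDim S := by
  apply le_antisymm
  · refine iSup_le fun c => ?_
    obtain ⟨P, -, hP, hPc⟩ := Ideal.exists_ideal_over_prime_of_isIntegral c.head.asIdeal
      (⊥ : Ideal S) (by
        rw [← RingHom.ker_eq_comap_bot, (RingHom.injective_iff_ker_eq_bot _).mp h]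
        exact bot_le)
    have : P.LiesOver c.head.asIdeal := ⟨hPc.symm⟩
    obtain ⟨L, hL, -⟩ := Ideal.exists_ltSeries_of_hasGoingUp c P
    exact hL ▸ Order.LTSeries.length_le_krullDim L
  · exact Order.krullDim_le_of_strictMono (PrimeSpectrum.comap (algebraMap R S))
      fun _ _ hIJ => Ideal.IsIntegral.comap_lt_comap hIJ

end IntegralDimension

section ShiftedMonomial

open Polynomial in
/-- The polynomial `∏ (X + u_j) ^ l_j` in one variable. -/
noncomputable def shiftedMonomial {A ι : Type*} [CommRing A] [Fintype ι] (u : ι → A) (l : ι → ℕ) :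
    A[X] :=
  ∏ j, (Polynomial.X + Polynomial.C (u j)) ^ l j

variable {A ι : Type*} [CommRing A] [Fintype ι] (u : ι → A) (l : ι → ℕ)

theorem shiftedMonomial_monic : (shiftedMonomial u l).Monic :=
  Polynomial.monic_prod_of_monic _ _ fun j _ => (Polynomial.monic_X_add_C (u j)).pow (l j)

theorem shiftedMonomial_natDegree [Nontrivial A] : (shiftedMonomial u l).natDegree = ∑ j, l j := by
  rw [shiftedMonomial, Polynomial.natDegree_prod_of_monic _ _
    fun j _ => (Polynomial.monic_X_add_C (u j)).pow (l j)]
  refine Finset.sum_congr rfl fun j _ => ?_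
  rw [(Polynomial.monic_X_add_C (u j)).natDegree_pow, Polynomial.natDegree_X_add_C, mul_one]

theorem shiftedMonomial_natDegree_ne_zero [Nontrivial A] [Nonempty ι] (hl : ∀ j, 0 < l j) :
    (shiftedMonomial u l).natDegree ≠ 0 := by
  rw [shiftedMonomial_natDegree]
  exact (Finset.sum_pos (fun j _ => hl j) Finset.univ_nonempty).ne'

theorem aeval_shiftedMonomial {B : Type*} [CommRing B] [Algebra A B] (z : B) :
    Polynomial.aeval z (shiftedMonomial u l) = ∏ j, (z + algebraMap A B (u j)) ^ l j := by
  simp [shiftedMonomial, map_prod]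

theorem exists_prod_shift_pow_eq {𝕂 : Type*} [Field 𝕂] [IsAlgClosed 𝕂] [Nonempty ι]
    (u : ι → 𝕂) (hl : ∀ j, 0 < l j) (c : 𝕂) : ∃ z, ∏ j, (z + u j) ^ l j = c := by
  have hdeg := shiftedMonomial_natDegree_ne_zero u l hl
  obtain ⟨z, hz⟩ := IsAlgClosed.exists_root (shiftedMonomial u l - Polynomial.C c) (by
    intro h
    apply hdeg
    rw [← Polynomial.natDegree_sub_C (a := c)]
    exact Polynomial.natDegree_eq_of_degree_eq_some h)
  refine ⟨z, ?_⟩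
  have h := aeval_shiftedMonomial u l z
  rw [Polynomial.IsRoot, Polynomial.eval_sub, Polynomial.eval_C, sub_eq_zero] at hz
  rw [Polynomial.coe_aeval_eq_eval, hz] at h
  exact h.symm

end ShiftedMonomial

section TrinomialRing

variable {𝕂 : Type} [Field 𝕂]
variable {r : ℕ} {a : Fin (r+1) → 𝕂 × 𝕂} {n : Fin (r+1) → ℕ}
variable {l : ∀ i : Fin (r+1), Fin (n i) → ℕ}

theorem alpha_ne_zero {i k : Fin (r+1)} (h : LinearIndependent 𝕂 ![a i, a k]) :
    alpha 𝕂 r a i k ≠ 0 := by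
  intro h0
  rw [LinearIndependent.pair_iff] at h
  unfold alpha at h0
  have h1 := h (a k).2 (-(a i).2) (by
    ext
    · simp; linear_combination h0
    · simp; ring)
  have h2 := h (a k).1 (-(a i).1) (by
    ext
    · simp; ring
    · simp; linear_combination -h0)
  have h3 := h 1 0 (by
    ext
    · simpa using h2.2
    · simpa using h1.2)
  exact one_ne_zero h3.1

/-- The first variable `T_{i1}` of the `i`-th block. -/
abbrev firstIdx (hn : ∀ i, 0 < n i) (i : Fin (r+1)) : Idx r n := ⟨i, ⟨0, hn i⟩⟩

/-- Parameters for a Noether normalization of `R(A, 𝔫, L)`: the non-first variables of each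
block together with two values for the first two monomials. -/
abbrev ParamIdx (r : ℕ) (n : Fin (r+1) → ℕ) := {x : Idx r n // (x.2 : ℕ) ≠ 0} ⊕ Fin 2

/-- The values of the parameters in `R(A, 𝔫, L)`: differences `T_{ij} - T_{i1}` and the
monomials `T_0^{l_0}`, `T_1^{l_1}`. -/
noncomputable def paramVal (a : Fin (r+1) → 𝕂 × 𝕂) (l : ∀ i : Fin (r+1), Fin (n i) → ℕ)
    (hn : ∀ i, 0 < n i) : ParamIdx r n → RAnL 𝕂 r a n l :=
  Sum.elim
    (fun x => Ideal.Quotient.mk _ (X x.1 - X (firstIdx hn x.1.1)))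
    ![Ideal.Quotient.mk _ (mono 𝕂 r n l 0), Ideal.Quotient.mk _ (mono 𝕂 r n l 1)]

/-- The Noether normalization map of `R(A, 𝔫, L)`. -/
noncomputable def paramMap (a : Fin (r+1) → 𝕂 × 𝕂) (l : ∀ i : Fin (r+1), Fin (n i) → ℕ)
    (hn : ∀ i, 0 < n i) : MvPolynomial (ParamIdx r n) 𝕂 →ₐ[𝕂] RAnL 𝕂 r a n l :=
  aeval (paramVal a l hn)

theorem mk_mono_mem_range (ha : ∀ i k : Fin (r+1), i ≠ k → LinearIndependent 𝕂 ![a i, a k])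
    (hn : ∀ i, 0 < n i) (i : Fin (r+1)) :
    Ideal.Quotient.mk (relIdeal 𝕂 r a n l) (mono 𝕂 r n l i) ∈ (paramMap a l hn).range := by
  obtain ⟨i, hi⟩ := i
  induction i using Nat.strong_induction_on with
  | _ i ih =>
  match i, hi, ih with
  | 0, hi, _ => exact ⟨X (Sum.inr 0), by simp [paramMap, paramVal]⟩
  | 1, hi, _ =>
    have h1 : (⟨1, hi⟩ : Fin (r+1)) = 1 := Fin.ext (by simp [Nat.mod_eq_of_lt hi])
    exact ⟨X (Sum.inr 1), by simp [paramMap, paramVal, h1]⟩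
  | i + 2, hi, ih =>
    set I : Fin (r+1) := ⟨i, by omega⟩
    set J : Fin (r+1) := ⟨i + 1, by omega⟩
    set K : Fin (r+1) := ⟨i + 2, hi⟩
    have hI := ih i (by omega) (by omega)
    have hJ := ih (i + 1) (by omega) (by omega)
    have hα : alpha 𝕂 r a I J ≠ 0 := alpha_ne_zero (ha I J (by simp [I, J]))
    have hg : Ideal.Quotient.mk (relIdeal 𝕂 r a n l) (gPoly 𝕂 r a n l I J K) = 0 :=
      Ideal.Quotient.eq_zero_iff_mem.mpr (Ideal.subset_span ⟨I, J, K, rfl, rfl, rfl⟩)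
    have key : Ideal.Quotient.mk (relIdeal 𝕂 r a n l) (mono 𝕂 r n l K) =
        -(algebraMap 𝕂 _ (alpha 𝕂 r a I J)⁻¹ *
          (algebraMap 𝕂 _ (alpha 𝕂 r a J K) * Ideal.Quotient.mk _ (mono 𝕂 r n l I) +
            algebraMap 𝕂 _ (alpha 𝕂 r a K I) * Ideal.Quotient.mk _ (mono 𝕂 r n l J))) := by
      have hinv : (algebraMap 𝕂 (RAnL 𝕂 r a n l) (alpha 𝕂 r a I J)⁻¹) *
          algebraMap 𝕂 (RAnL 𝕂 r a n l) (alpha 𝕂 r a I J) = 1 := by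
        rw [← map_mul, inv_mul_cancel₀ hα, map_one]
      have hC : ∀ c : 𝕂, Ideal.Quotient.mk (relIdeal 𝕂 r a n l) (C c) =
        algebraMap 𝕂 (RAnL 𝕂 r a n l) c := fun _ => rfl
      simp only [gPoly, map_add, map_mul, hC] at hg
      linear_combination (algebraMap 𝕂 (RAnL 𝕂 r a n l) (alpha 𝕂 r a I J)⁻¹) * hg -
        Ideal.Quotient.mk (relIdeal 𝕂 r a n l) (mono 𝕂 r n l K) * hinv
    rw [key]
    exact neg_mem (mul_mem (algebraMap_mem _ _) (add_mem (mul_mem (algebraMap_mem _ _) hI)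
      (mul_mem (algebraMap_mem _ _) hJ)))

theorem paramMap_isIntegral (ha : ∀ i k : Fin (r+1), i ≠ k → LinearIndependent 𝕂 ![a i, a k])
    (hn : ∀ i, 0 < n i) (hl : ∀ i j, 0 < l i j) :
    (paramMap a l hn).toRingHom.IsIntegral := by
  let _ : Algebra (MvPolynomial (ParamIdx r n) 𝕂) (RAnL 𝕂 r a n l) :=
    (paramMap a l hn).toRingHom.toAlgebra
  have hmap : ∀ p, algebraMap (MvPolynomial (ParamIdx r n) 𝕂) (RAnL 𝕂 r a n l) p =
    paramMap a l hn p := fun _ => rfl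
  have hrange : ∀ y ∈ (paramMap a l hn).range,
      IsIntegral (MvPolynomial (ParamIdx r n) 𝕂) y := by
    rintro _ ⟨p, rfl⟩
    exact isIntegral_algebraMap (x := p)
  have hdiff : ∀ x : Idx r n, ∃ p, paramMap a l hn p =
      Ideal.Quotient.mk _ (X x - X (firstIdx hn x.1)) := by
    rintro ⟨i, j⟩
    by_cases hj : (j : ℕ) = 0
    · obtain rfl : j = ⟨0, hn i⟩ := Fin.ext hj
      exact ⟨0, by simp⟩
    · exact ⟨X (Sum.inl ⟨⟨i, j⟩, hj⟩), by simp [paramMap, paramVal]⟩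
  choose u hu using hdiff
  have hfirst : ∀ i, IsIntegral (MvPolynomial (ParamIdx r n) 𝕂)
      (Ideal.Quotient.mk (relIdeal 𝕂 r a n l) (X (firstIdx hn i))) := by
    intro i
    have : Nonempty (Fin (n i)) := ⟨⟨0, hn i⟩⟩
    refine IsIntegral.of_aeval_monic (shiftedMonomial_monic (fun j => u ⟨i, j⟩) (l i))
      (shiftedMonomial_natDegree_ne_zero _ _ (hl i)) ?_
    have hprod : Polynomial.aeval (Ideal.Quotient.mk (relIdeal 𝕂 r a n l) (X (firstIdx hn i)))
        (shiftedMonomial (fun j => u ⟨i, j⟩) (l i)) =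
        Ideal.Quotient.mk (relIdeal 𝕂 r a n l) (mono 𝕂 r n l i) := by
      rw [aeval_shiftedMonomial]
      simp [mono, map_prod, hmap, hu]
    rw [hprod]
    exact hrange _ (mk_mono_mem_range ha hn i)
  change ∀ y : RAnL 𝕂 r a n l, IsIntegral (MvPolynomial (ParamIdx r n) 𝕂) y
  intro y
  obtain ⟨p, rfl⟩ := Ideal.Quotient.mk_surjective y
  induction p using MvPolynomial.induction_on with
  | C c => exact hrange _ ⟨C c, by simp [paramMap]; rfl⟩
  | add p q hp hq => rw [map_add]; exact hp.add hq
  | mul_X p x hp =>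
    rw [map_mul]
    refine hp.mul ?_
    have h := (hrange _ ⟨_, hu x⟩).add (hfirst x.1)
    rwa [← map_add, sub_add_cancel] at h

theorem exists_point [IsAlgClosed 𝕂]
    (ha : ∀ i k : Fin (r+1), i ≠ k → LinearIndependent 𝕂 ![a i, a k])
    (hr : 1 ≤ r) (hn : ∀ i, 0 < n i) (hl : ∀ i j, 0 < l i j) (s : ParamIdx r n → 𝕂) :
    ∃ t : Idx r n → 𝕂, (∀ p ∈ relIdeal 𝕂 r a n l, aeval t p = 0) ∧
      (∀ x, t x.1 - t (firstIdx hn x.1.1) = s (Sum.inl x)) ∧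
      aeval t (mono 𝕂 r n l 0) = s (Sum.inr 0) ∧ aeval t (mono 𝕂 r n l 1) = s (Sum.inr 1) := by
  have hα : alpha 𝕂 r a 0 1 ≠ 0 := alpha_ne_zero (ha 0 1 (by
    intro h
    have := congrArg Fin.val h
    rw [Fin.val_one', Nat.mod_eq_of_lt (by omega)] at this
    simp at this))
  set x : 𝕂 := (s (Sum.inr 0) * (a 1).2 - s (Sum.inr 1) * (a 0).2) / alpha 𝕂 r a 0 1 with hx
  set y : 𝕂 := ((a 0).1 * s (Sum.inr 1) - (a 1).1 * s (Sum.inr 0)) / alpha 𝕂 r a 0 1 with hy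
  let u : ∀ i, Fin (n i) → 𝕂 := fun i j =>
    if h : (j : ℕ) ≠ 0 then s (Sum.inl ⟨⟨i, j⟩, h⟩) else 0
  have hroot : ∀ i, ∃ z, ∏ j, (z + u i j) ^ l i j = (a i).1 * x + (a i).2 * y := fun i =>
    have : Nonempty (Fin (n i)) := ⟨⟨0, hn i⟩⟩
    exists_prod_shift_pow_eq _ _ (hl i) _
  choose z hz using hroot
  have hmono : ∀ i, aeval (fun x : Idx r n => z x.1 + u x.1 x.2) (mono 𝕂 r n l i) =
      (a i).1 * x + (a i).2 * y := fun i => by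
    rw [← hz i]
    simp [mono, map_prod]
  refine ⟨fun x => z x.1 + u x.1 x.2, fun p hp => ?_, ?_, ?_, ?_⟩
  · change p ∈ RingHom.ker (aeval (fun x : Idx r n => z x.1 + u x.1 x.2))
    refine (Ideal.span_le.mpr ?_ : relIdeal 𝕂 r a n l ≤ _) hp
    rintro _ ⟨i, j, k, -, -, rfl⟩
    simp only [SetLike.mem_coe, RingHom.mem_ker, gPoly, map_add, map_mul, hmono, aeval_C,
      Algebra.algebraMap_self, RingHom.id_apply, alpha]
    ring
  · rintro ⟨⟨i, j⟩, h⟩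
    have h' : (j : ℕ) ≠ 0 := h
    simp [u, h']
  · rw [hmono, hx, hy]
    field_simp
    unfold alpha
    ring
  · rw [hmono, hx, hy]
    field_simp
    unfold alpha
    ring

theorem paramMap_injective [IsAlgClosed 𝕂]
    (ha : ∀ i k : Fin (r+1), i ≠ k → LinearIndependent 𝕂 ![a i, a k])
    (hr : 1 ≤ r) (hn : ∀ i, 0 < n i) (hl : ∀ i j, 0 < l i j) :
    Function.Injective (paramMap a l hn) := by
  have : Infinite 𝕂 := IsAlgClosed.instInfinite
  rw [injective_iff_map_eq_zero]
  intro p hp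
  refine MvPolynomial.funext fun s => ?_
  obtain ⟨t, ht, hdiff, h0, h1⟩ := exists_point ha hr hn hl s
  have hcomp : (Ideal.Quotient.liftₐ (relIdeal 𝕂 r a n l) (aeval t) ht).comp (paramMap a l hn) =
      aeval s := by
    ext v
    rcases v with v | v
    · rw [aeval_X, ← hdiff]
      simp [paramMap, paramVal]
    · fin_cases v
      · simpa [paramMap, paramVal] using h0
      · simpa [paramMap, paramVal] using h1
  have h := DFunLike.congr_fun hcomp p
  rw [AlgHom.comp_apply, hp, map_zero] at h
  rw [map_zero, h, aeval_eq_eval]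

theorem le_sum_of_pos (hn : ∀ i, 0 < n i) : r + 1 ≤ ∑ i, n i := by
  simpa using Finset.card_nsmul_le_sum Finset.univ n 1 fun i _ => hn i

theorem card_paramIdx (hn : ∀ i, 0 < n i) :
    Fintype.card (ParamIdx r n) = (∑ i, n i) - r + 1 := by
  have e : {x : Idx r n // (x.2 : ℕ) = 0} ≃ Fin (r+1) :=
    { toFun := fun x => x.1.1
      invFun := fun i => ⟨firstIdx hn i, rfl⟩
      left_inv := by
        rintro ⟨⟨i, j⟩, h⟩
        obtain rfl : j = ⟨0, hn i⟩ := Fin.ext h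
        rfl
      right_inv := fun _ => rfl }
  have h := Fintype.card_subtype_compl (fun x : Idx r n => (x.2 : ℕ) = 0)
  rw [Fintype.card_congr e, Fintype.card_sigma] at h
  simp only [Fintype.card_fin] at h
  rw [Fintype.card_sum, Fintype.card_fin, h]
  have := le_sum_of_pos hn
  omega

theorem ringKrullDim_RAnL [IsAlgClosed 𝕂]
    (ha : ∀ i k : Fin (r+1), i ≠ k → LinearIndependent 𝕂 ![a i, a k])
    (hr : 1 ≤ r) (hn : ∀ i, 0 < n i) (hl : ∀ i j, 0 < l i j) :
    ringKrullDim (RAnL 𝕂 r a n l) = (((∑ i, n i) - r + 1 : ℕ) : WithBot ℕ∞) := by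
  let _ : Algebra (MvPolynomial (ParamIdx r n) 𝕂) (RAnL 𝕂 r a n l) :=
    (paramMap a l hn).toRingHom.toAlgebra
  have : Algebra.IsIntegral (MvPolynomial (ParamIdx r n) 𝕂) (RAnL 𝕂 r a n l) :=
    ⟨paramMap_isIntegral ha hn hl⟩
  rw [← ringKrullDim_eq_of_isIntegral_of_injective (R := MvPolynomial (ParamIdx r n) 𝕂)
    (paramMap_injective ha hr hn hl), MvPolynomial.ringKrullDim_of_isNoetherianRing,
    ringKrullDim_eq_zero_of_field, zero_add, Nat.card_eq_fintype_card, card_paramIdx hn]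

theorem linearIndependent_Prow (hn : ∀ i, 0 < n i) (hl : ∀ i j, 0 < l i j) :
    LinearIndependent ℤ (Prow r n l) := by
  rw [Fintype.linearIndependent_iff]
  intro c hc i
  have h := congrFun hc (firstIdx hn i.succ)
  have hl' := hl i.succ ⟨0, hn i.succ⟩
  simp only [Finset.sum_apply, Pi.smul_apply, Prow, Fin.succ_ne_zero, if_false,
    Fin.succ_inj, smul_eq_mul, mul_ite, mul_zero, Finset.sum_ite_eq, Finset.mem_univ, if_true,
    Pi.zero_apply, mul_eq_zero, Nat.cast_eq_zero] at h
  exact h.resolve_right hl'.ne'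

theorem rank_Kgrp (hn : ∀ i, 0 < n i) (hl : ∀ i j, 0 < l i j) :
    Module.rank ℤ (Kgrp r n l) = (((∑ i, n i) - r : ℕ) : Cardinal) := by
  have hli := linearIndependent_Prow hn hl
  have hker : LinearMap.ker (Qmap r n l).toIntLinearMap =
      Submodule.span ℤ (Set.range (Prow r n l)) := by
    ext v
    rw [← Submodule.mem_toAddSubgroup (Submodule.span ℤ _), Submodule.span_int_eq_addSubgroupClosure]
    exact QuotientAddGroup.eq_zero_iff v
  have h := LinearMap.rank_eq_of_surjective (f := (Qmap r n l).toIntLinearMap)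
    (QuotientAddGroup.mk'_surjective _)
  rw [hker, rank_span hli, Cardinal.mk_range_eq _ hli.injective, Cardinal.mk_fin, rank_fun',
    Fintype.card_sigma] at h
  simp only [Fintype.card_fin] at h
  have hle := le_sum_of_pos hn
  refine Cardinal.eq_of_add_eq_add_right (b := (r : Cardinal)) ?_ Cardinal.natCast_lt_aleph0
  rw [← h, ← Nat.cast_add, Nat.sub_add_cancel (by omega)]

end TrinomialRing

section Statement3

/-- `dim R(A,𝔫,L) = n - r + 1` and `rank K = n - r`; hence the `K`-grading is of
complexity one: `rank K = dim R(A,𝔫,L) - 1`. -/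
theorem statement3 (𝕂 : Type) [Field 𝕂] [IsAlgClosed 𝕂] [CharZero 𝕂]
    (r : ℕ) (hr : 1 ≤ r) (a : Fin (r+1) → 𝕂 × 𝕂)
    (ha : ∀ i k : Fin (r+1), i ≠ k → LinearIndependent 𝕂 ![a i, a k])
    (n : Fin (r+1) → ℕ) (hn : ∀ i, 0 < n i)
    (l : ∀ i : Fin (r+1), Fin (n i) → ℕ) (hl : ∀ i j, 0 < l i j) :
    ringKrullDim (RAnL 𝕂 r a n l) = (((∑ i, n i) - r + 1 : ℕ) : WithBot ℕ∞) ∧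
    Module.rank ℤ (Kgrp r n l) = (((∑ i, n i) - r : ℕ) : Cardinal) ∧
    ∃ d : ℕ, Module.rank ℤ (Kgrp r n l) = (d : Cardinal) ∧
      ringKrullDim (RAnL 𝕂 r a n l) = ((d + 1 : ℕ) : WithBot ℕ∞) :=
  ⟨ringKrullDim_RAnL ha hr hn hl, rank_Kgrp hn hl, (∑ i, n i) - r, rank_Kgrp hn hl,
    ringKrullDim_RAnL ha hr hn hl⟩

end Statement3
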